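/- arXiv:1608.02022 — 2 statements merged into one kernel-verified Lean document; each statement's English description precedes it below -/
import Mathlib

section
/- Let a and b be positive integers with a ≡ b (mod 2), b² < 6a and 5a < b² + 2b + 6. Suppose that a ≡ 3 (mod 9) or 3 does not divide b. Then there exist nonnegative integers s, t, u, v such that a = s² + t² + u² + 3v² and b = s + t + u + 3v. -/
def QF (a b c r s t x y z : ℤ) : ℤ :=
  a * x ^ 2 + b * y ^ 2 + c * z ^ 2 + 2 * r * y * z + 2 * s * x * z + 2 * t * x * y

structure GoodF (N a b c r s t : ℤ) : Prop where
  ha : 0 < a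
  hd : 0 < a * b - t ^ 2
  hdet : a * b * c + 2 * r * s * t - a * r ^ 2 - b * s ^ 2 - c * t ^ 2 = 3
  h9 : ∀ x y z, QF a b c r s t x y z % 9 ≠ 6
  hN : ∃ x y z, QF a b c r s t x y z = N

lemma round_exists (t a : ℤ) (ha : 0 < a) : ∃ k : ℤ, 2 * (t + k * a) ≤ a ∧ -a ≤ 2 * (t + k * a) := by
  refine ⟨-((2 * t + a) / (2 * a)), ?_⟩
  have h1 := Int.emod_add_mul_ediv (2 * t + a) (2 * a)
  have h2 := Int.emod_nonneg (2 * t + a) (b := 2 * a) (by omega)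
  have h3 := Int.emod_lt_of_pos (2 * t + a) (b := 2 * a) (by omega)
  constructor <;> nlinarith

lemma GoodF.shift1 {N a b c r s t : ℤ} (h : GoodF N a b c r s t) (k : ℤ) :
    GoodF N a (b + 2 * k * t + k ^ 2 * a) c (r + k * s) s (t + k * a) := by
  obtain ⟨h1, h2, h3, h4, x, y, z, h5⟩ := h
  refine ⟨h1, by linarith, by linarith, fun x y z => ?_, x - k * y, y, z, ?_⟩
  · have := h4 (x + k * y) y z
    convert this using 2
    unfold QF; ring
  · rw [← h5]; unfold QF; ring

lemma GoodF.shift2 {N a b c r s t : ℤ} (h : GoodF N a b c r s t) (k : ℤ) :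
    GoodF N a b (c + 2 * k * r + k ^ 2 * b) (r + k * b) (s + k * t) t := by
  obtain ⟨h1, h2, h3, h4, x, y, z, h5⟩ := h
  refine ⟨h1, by linarith, by linarith, fun x y z => ?_, x, y - k * z, z, ?_⟩
  · have := h4 x (y + k * z) z
    convert this using 2
    unfold QF; ring
  · rw [← h5]; unfold QF; ring

lemma GoodF.swapxy {N a b c r s t : ℤ} (h : GoodF N a b c r s t) :
    GoodF N b a c s r t := by
  obtain ⟨h1, h2, h3, h4, x, y, z, h5⟩ := h
  refine ⟨by nlinarith [sq_nonneg t], by linarith, by linarith, fun x y z => ?_, y, x, z, ?_⟩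
  · have := h4 y x z
    convert this using 2
    unfold QF; ring
  · rw [← h5]; unfold QF; ring

lemma GoodF.swapyz {N a b c r s t : ℤ} (h : GoodF N a b c r s t) :
    GoodF N a c b r t s := by
  obtain ⟨h1, h2, h3, h4, x, y, z, h5⟩ := h
  have key : (a * b - t ^ 2) * (a * c - s ^ 2) = 3 * a + (a * r - s * t) ^ 2 := by
    linear_combination a * h3
  refine ⟨h1, by nlinarith [sq_nonneg (a * r - s * t)], by linarith, fun x y z => ?_, x, z, y, ?_⟩
  · have := h4 x z y
    convert this using 2
    unfold QF; ring
  · rw [← h5]; unfold QF; ring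

lemma GoodF.final {N a b c r s t : ℤ} (h : GoodF N a b c r s t)
    (hab : a ≤ b) (hAC : a * b - t ^ 2 ≤ a * c - s ^ 2)
    (ht1 : 2 * t ≤ a) (ht2 : -a ≤ 2 * t)
    (hB1 : 2 * (a * r - s * t) ≤ a * b - t ^ 2) (hB2 : -(a * b - t ^ 2) ≤ 2 * (a * r - s * t)) :
    ∃ x y z : ℤ, N = x ^ 2 + y ^ 2 + 3 * z ^ 2 := by
  obtain ⟨h1, h2, h3, h4, x, y, z, h5⟩ := h
  have key : (a * b - t ^ 2) * (a * c - s ^ 2) = 3 * a + (a * r - s * t) ^ 2 := by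
    linear_combination a * h3
  have e1 : (a * b - t ^ 2) ^ 2 ≤ 4 * a := by
    nlinarith
  have e2 : 3 * a ^ 2 ≤ 4 * (a * b - t ^ 2) := by nlinarith
  have ha1 : a = 1 := by
    by_contra hne
    have ha2 : 2 ≤ a := by omega
    have e3 : (3 * a ^ 2) ^ 2 ≤ (4 * (a * b - t ^ 2)) ^ 2 :=
      pow_le_pow_left₀ (by positivity) e2 2
    have e4 : 9 * a ^ 4 ≤ 64 * a := by nlinarith
    have e5 : 8 ≤ a ^ 3 := by
      have := pow_le_pow_left₀ (by norm_num) ha2 3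
      linarith
    nlinarith
  subst ha1
  have ht : t = 0 := by omega
  subst ht
  have hb2 : b ≤ 2 := by nlinarith
  have hb1 : 1 ≤ b := hab
  have hbb : b = 1 ∨ b = 2 := by omega
  rcases hbb with rfl | rfl
  · have hr : r = 0 := by omega
    subst hr
    have hc : c = s ^ 2 + 3 := by linarith
    refine ⟨x + s * z, y, z, ?_⟩
    rw [← h5, hc]; unfold QF; ring
  · exfalso
    have hr : r = -1 ∨ r = 0 ∨ r = 1 := by omega
    rcases hr with rfl | rfl | rfl
    · have := h4 s 1 (-1)
      have hc : c = s ^ 2 + 2 := by linarith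
      apply this
      rw [hc]; unfold QF; ring_nf; norm_num
    · omega
    · have := h4 (-s) 1 1
      have hc : c = s ^ 2 + 2 := by linarith
      apply this
      rw [hc]; unfold QF; ring_nf; norm_num

lemma GoodF.reduce (N : ℤ) : ∀ n m : ℕ, ∀ a b c r s t : ℤ, a.toNat = n →
    (a * b - t ^ 2).toNat = m → GoodF N a b c r s t →
    ∃ x y z : ℤ, N = x ^ 2 + y ^ 2 + 3 * z ^ 2 := by
  intro n
  induction n using Nat.strong_induction_on with
  | _ n ihn =>
  intro m
  induction m using Nat.strong_induction_on with
  | _ m ihm =>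
  intro a b c r s t hn hm h
  obtain ⟨k, hk1, hk2⟩ := round_exists t a h.ha
  have h' := h.shift1 k
  have hA : a * (b + 2 * k * t + k ^ 2 * a) - (t + k * a) ^ 2 = a * b - t ^ 2 := by ring
  rw [← hA] at hm
  generalize b + 2 * k * t + k ^ 2 * a = b' at *
  generalize t + k * a = t' at *
  generalize r + k * s = r' at *
  clear hA h
  obtain ⟨l, hl1, hl2⟩ := round_exists (a * r' - s * t') (a * b' - t' ^ 2) h'.hd
  have h'' := h'.shift2 l
  have hB : a * r' - s * t' + l * (a * b' - t' ^ 2) = a * (r' + l * b') - (s + l * t') * t' := by ring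
  rw [hB] at hl1 hl2
  generalize c + 2 * l * r' + l ^ 2 * b' = c' at *
  generalize r' + l * b' = r'' at *
  generalize s + l * t' = s' at *
  have p1 := h''.ha
  have p2 := h''.hd
  by_cases hab : a ≤ b'
  · by_cases hAC : a * b' - t' ^ 2 ≤ a * c' - s' ^ 2
    · exact h''.final hab hAC hk1 hk2 hl1 hl2
    · exact ihm (a * c' - s' ^ 2).toNat (by omega) _ _ _ _ _ _ hn rfl h''.swapyz
  · exact ihn b'.toNat (by omega) _ _ _ _ _ _ _ rfl rfl h''.swapxy

lemma exists_prime_data (N : ℕ) (hN : 0 < N) (h3 : ¬ 3 ∣ N) :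
    ∃ p d : ℕ, p.Prime ∧ d % 12 = 1 ∧ p + 3 = 4 * N * d := by
  have hc : (4 * N - 3).Coprime (48 * N) := by
    have h34 : (4 * N - 3).Coprime 3 := by
      rw [Nat.coprime_comm, Nat.Prime.coprime_iff_not_dvd Nat.prime_three]; omega
    have hN3 : Nat.Coprime N 3 := by
      rw [Nat.coprime_comm, Nat.Prime.coprime_iff_not_dvd Nat.prime_three]; omega
    have h2 : (4 * N - 3).Coprime 2 := by
      rw [Nat.coprime_comm, Nat.Prime.coprime_iff_not_dvd Nat.prime_two]; omega
    have hNN : (4 * N - 3).Coprime N := by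
      apply Nat.Coprime.symm
      have e : 4 * N - 3 + 3 = 4 * N := by omega
      refine Nat.Coprime.of_dvd_right (dvd_refl _) ?_
      rw [Nat.coprime_iff_gcd_eq_one] at *
      have hg1 := Nat.gcd_dvd_left N (4 * N - 3)
      have hg2 := Nat.gcd_dvd_right N (4 * N - 3)
      have hg3 : N.gcd (4 * N - 3) ∣ 3 := by
        rw [← Nat.dvd_add_right hg2, e]
        exact Dvd.dvd.mul_left hg1 4
      have := Nat.dvd_gcd hg1 hg3
      rw [hN3] at this
      exact Nat.dvd_one.mp this
    have : 48 * N = 2 ^ 4 * 3 * N := by ring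
    rw [this]
    exact Nat.Coprime.mul_right (Nat.Coprime.mul_right (h2.pow_right 4) h34) hNN
  obtain ⟨p, hp, hpp, hmod⟩ := Nat.forall_exists_prime_gt_and_modEq (4 * N - 3)
    (q := 48 * N) (by omega) hc
  have hdvd := (Nat.modEq_iff_dvd' hp.le).mp hmod.symm
  obtain ⟨k, hk⟩ := hdvd
  refine ⟨p, 12 * k + 1, hpp, by omega, ?_⟩
  have : p = 48 * N * k + (4 * N - 3) := by omega
  have e : 4 * N * (12 * k + 1) = 48 * N * k + 4 * N := by ring
  rw [e]; omega

open NumberTheorySymbols in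
lemma neg_d_square (N p d : ℕ) (hp : p.Prime) (hd : d % 12 = 1) (h : p + 3 = 4 * N * d) :
    ∃ m k : ℤ, m ^ 2 + 4 * d = p * k := by
  have : Fact p.Prime := ⟨hp⟩
  have hp4 : p % 4 = 1 := by
    have : 4 * N * d = 4 * (N * d) := by ring
    omega
  have hdo : Odd d := Nat.odd_iff.mpr (by omega)
  have hpo : Odd p := Nat.odd_iff.mpr (by omega)
  have j3 : J((3 : ℕ) | d) = 1 := by
    rw [jacobiSym.quadratic_reciprocity_one_mod_four' (by decide) (by omega : d % 4 = 1),
      jacobiSym.mod_left]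
    have : ((d : ℤ) % (3 : ℕ)) = 1 := by omega
    rw [this]; exact jacobiSym.one_left 3
  have jm3 : J(-3 | d) = 1 := by
    rw [jacobiSym.neg _ hdo, ZMod.χ₄_nat_one_mod_four (by omega), one_mul]
    exact_mod_cast j3
  have jd : J((d : ℤ) | p) = 1 := by
    rw [jacobiSym.quadratic_reciprocity_one_mod_four' hdo hp4]
    rw [← jm3]
    apply jacobiSym.mod_left'
    apply Int.emod_emod_of_dvd _ (dvd_refl _) |>.symm.trans
    rw [Int.emod_emod_of_dvd _ (dvd_refl _)]
    apply Int.ModEq.symm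
    rw [Int.modEq_iff_dvd]
    refine ⟨4 * N, ?_⟩
    have : (p : ℤ) + 3 = 4 * N * d := by exact_mod_cast h
    linarith
  have jmd : J(-(d : ℤ) | p) = 1 := by
    rw [jacobiSym.neg _ hpo, ZMod.χ₄_nat_one_mod_four hp4, one_mul, jd]
  have hs := ZMod.isSquare_of_jacobiSym_eq_one jmd
  obtain ⟨w, hw⟩ := hs
  obtain ⟨m, rfl⟩ := ZMod.intCast_surjective w
  have : ((m * m + d : ℤ) : ZMod p) = 0 := by
    push_cast at hw ⊢
    rw [← hw]; ring
  rw [ZMod.intCast_zmod_eq_zero_iff_dvd] at this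
  obtain ⟨k, hk⟩ := this
  exact ⟨2 * m, 4 * k, by linear_combination 4 * hk⟩

lemma rep113 (N : ℕ) (hN : 0 < N) (h3 : ¬ 3 ∣ N) :
    ∃ x y z : ℤ, (N : ℤ) = x ^ 2 + y ^ 2 + 3 * z ^ 2 := by
  obtain ⟨p, d, hp, hd, hpd⟩ := exists_prime_data N hN h3
  obtain ⟨m, k, hmk⟩ := neg_d_square N p d hp hd hpd
  have hp0 : (0 : ℤ) < p := by exact_mod_cast hp.pos
  have hd0 : (0 : ℤ) < d := by omega
  have hpd' : (p : ℤ) + 3 = 4 * N * d := by exact_mod_cast hpd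
  have hk0 : 0 < k := by nlinarith [sq_nonneg m]
  have hpN : ((p : ℤ) - N) % 3 = 0 := by
    obtain ⟨e, he⟩ : ∃ e, d = 12 * e + 1 := ⟨d / 12, by omega⟩
    subst he
    push_cast at hpd'
    have : (p : ℤ) - N = 3 * (16 * N * e + N - 1) := by linear_combination hpd'
    omega
  refine GoodF.reduce N _ _ k p N 0 1 m rfl rfl ⟨hk0, ?_, ?_, ?_, 0, 0, 1, ?_⟩
  · linarith
  · linear_combination (-(N : ℤ)) * hmk - hpd'
  · intro x y z hQ
    have id1 : (N : ℤ) ^ 2 * p * QF k p N 0 1 m x y z =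
        N * p * (N * z + x) ^ 2 + (N * p * y + N * m * x) ^ 2 + 3 * N * x ^ 2 := by
      unfold QF
      linear_combination (-(N:ℤ)^2 * x^2) * hmk - (N * x^2) * hpd'
    generalize QF k p N 0 1 m x y z = q at *
    obtain ⟨j, hj⟩ : ∃ j, (p : ℤ) = N + 3 * j := ⟨(p - N) / 3, by omega⟩
    obtain ⟨i, hi⟩ : ∃ i, q = 9 * i + 6 := ⟨q / 9, by omega⟩
    generalize hX : (N : ℤ) * z + x = X at *
    generalize hY : (N : ℤ) * p * y + N * m * x = Y at *
    have hN3 : (N : ℤ) % 3 = 1 ∨ (N : ℤ) % 3 = 2 := by omega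
    have hXY : X % 3 = 0 ∧ Y % 3 = 0 := by
      have : (X ^ 2 + Y ^ 2) % 3 = 0 := by
        obtain ⟨g, hg⟩ : ∃ g, (N : ℤ) ^ 2 = 3 * g + 1 := by
          rcases hN3 with h | h
          · exact ⟨((N : ℤ) ^ 2 - 1) / 3, by have : (N : ℤ) ^ 2 % 3 = 1 := by simp [pow_two, Int.mul_emod, h]
                                             omega⟩
          · exact ⟨((N : ℤ) ^ 2 - 1) / 3, by have : (N : ℤ) ^ 2 % 3 = 1 := by simp [pow_two, Int.mul_emod, h]
                                             omega⟩
        have : X ^ 2 + Y ^ 2 = 3 * ((N : ℤ) ^ 2 * p * (3 * i + 2) - g * X ^ 2 - N * j * X ^ 2 - N * x ^ 2) := by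
          rw [hi] at id1
          linear_combination -id1 - X ^ 2 * hg - N * X ^ 2 * hj
        omega
      have hx : X % 3 = 0 ∨ X % 3 = 1 ∨ X % 3 = 2 := by omega
      have hy : Y % 3 = 0 ∨ Y % 3 = 1 ∨ Y % 3 = 2 := by omega
      rcases hx with hx | hx | hx <;> rcases hy with hy | hy | hy <;>
        simp [pow_two, Int.add_emod, Int.mul_emod, hx, hy] at this ⊢
    obtain ⟨X', rfl⟩ : ∃ X', X = 3 * X' := ⟨X / 3, by omega⟩
    obtain ⟨Y', rfl⟩ : ∃ Y', Y = 3 * Y' := ⟨Y / 3, by omega⟩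
    have e : (N : ℤ) * x ^ 2 - 2 * N ^ 2 * p = 3 * (N ^ 2 * p * i - N * p * X' ^ 2 - Y' ^ 2) := by
      rw [hi] at id1
      linarith
    have e' : ((N : ℤ) * x ^ 2 - 2 * N ^ 2 * p) % 3 = 0 := by omega
    have hp3 : (p : ℤ) % 3 = N % 3 := by omega
    have hx : x % 3 = 0 ∨ x % 3 = 1 ∨ x % 3 = 2 := by omega
    rcases hN3 with h | h <;> rw [h] at hp3 <;> rcases hx with hx | hx | hx <;>
      simp [pow_two, Int.sub_emod, Int.mul_emod, h, hp3, hx] at e'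
  · unfold QF; ring

lemma rep_form (N : ℤ) (h4 : N % 4 = 0 ∨ N % 4 = 1)
    (h : ∃ x y z : ℤ, N = x ^ 2 + y ^ 2 + 3 * z ^ 2) :
    ∃ z x y : ℤ, N = z ^ 2 + 4 * (x ^ 2 + x * y + y ^ 2) := by
  obtain ⟨x, y, z, h⟩ := h
  have key : y % 2 = z % 2 ∨ x % 2 = z % 2 := by
    by_contra hc
    push Not at hc
    obtain ⟨i, hi⟩ : ∃ i, x = 2 * i + x % 2 := ⟨x / 2, by omega⟩
    obtain ⟨j, hj⟩ : ∃ i, y = 2 * i + y % 2 := ⟨y / 2, by omega⟩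
    obtain ⟨k, hk⟩ : ∃ i, z = 2 * i + z % 2 := ⟨z / 2, by omega⟩
    rcases Int.emod_two_eq_zero_or_one z with hz | hz
    · have hx : x % 2 = 1 := by omega
      have hy : y % 2 = 1 := by omega
      rw [hx] at hi; rw [hy] at hj; rw [hz] at hk
      have : N = 4 * (i ^ 2 + i + j ^ 2 + j + 3 * k ^ 2) + 2 := by
        rw [h, hi, hj, hk]; ring
      omega
    · have hx : x % 2 = 0 := by omega
      have hy : y % 2 = 0 := by omega
      rw [hx] at hi; rw [hy] at hj; rw [hz] at hk
      have : N = 4 * (i ^ 2 + j ^ 2 + 3 * k ^ 2 + 3 * k) + 3 := by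
        rw [h, hi, hj, hk]; ring
      omega
  rcases key with hk | hk
  · obtain ⟨i, hi⟩ : ∃ i, y = 2 * i + z := ⟨(y - z) / 2, by omega⟩
    exact ⟨x, i, z, by rw [h, hi]; ring⟩
  · obtain ⟨i, hi⟩ : ∃ i, x = 2 * i + z := ⟨(x - z) / 2, by omega⟩
    exact ⟨y, i, z, by rw [h, hi]; ring⟩

lemma sq_mod3 (b z e : ℤ) (h : (z ^ 2 + e ^ 2 + b ^ 2) % 3 = 0) :
    (z % 3 = b % 3 ∨ (-z) % 3 = b % 3) ∧ (e % 3 = b % 3 ∨ (-e) % 3 = b % 3) := by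
  have hb : b % 3 = 0 ∨ b % 3 = 1 ∨ b % 3 = 2 := by omega
  have hz : z % 3 = 0 ∨ z % 3 = 1 ∨ z % 3 = 2 := by omega
  have he : e % 3 = 0 ∨ e % 3 = 1 ∨ e % 3 = 2 := by omega
  rcases hb with hb | hb | hb <;> rcases hz with hz | hz | hz <;> rcases he with he | he | he <;>
    first
    | omega
    | (exfalso; simp [pow_two, Int.add_emod, Int.mul_emod, hb, hz, he] at h)

lemma int_rep (a b : ℤ) (h : ∃ z x y : ℤ, 6 * a - b ^ 2 = z ^ 2 + 4 * (x ^ 2 + x * y + y ^ 2)) :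
    ∃ s t u v : ℤ, a = s ^ 2 + t ^ 2 + u ^ 2 + 3 * v ^ 2 ∧ b = s + t + u + 3 * v := by
  obtain ⟨z, x, y, h⟩ := h
  have hm := sq_mod3 b z (x - y) (by
    have : z ^ 2 + (x - y) ^ 2 + b ^ 2 = 3 * (2 * a - x ^ 2 - 2 * x * y - y ^ 2) := by
      linear_combination -h
    omega)
  have h2 : (z - b) % 2 = 0 := by
    have : (z - b) ^ 2 = 2 * (3 * a - 2 * (x ^ 2 + x * y + y ^ 2) - z * b) := by
      linear_combination -h
    have he : Even ((z - b) ^ 2) := ⟨_, this.trans (two_mul _)⟩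
    exact Int.even_iff.mp ((Int.even_pow' (by norm_num)).mp he)
  obtain ⟨z', hz', hz2, hzz⟩ : ∃ z', z' % 3 = b % 3 ∧ (z' - b) % 2 = 0 ∧ z' ^ 2 = z ^ 2 := by
    rcases hm.1 with hh | hh
    · exact ⟨z, hh, h2, rfl⟩
    · exact ⟨-z, hh, by omega, by ring⟩
  obtain ⟨x', y', he, hxy⟩ : ∃ x' y', (x' - y') % 3 = b % 3 ∧
      x' ^ 2 + x' * y' + y' ^ 2 = x ^ 2 + x * y + y ^ 2 := by
    rcases hm.2 with hh | hh
    · exact ⟨x, y, hh, rfl⟩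
    · exact ⟨-x, -y, by omega, by ring⟩
  rw [← hzz, ← hxy] at h
  obtain ⟨v, hv⟩ : ∃ v, z' = b - 6 * v := ⟨(b - z') / 6, by omega⟩
  obtain ⟨t, ht⟩ : ∃ t, b - 3 * v = 3 * t + x' - y' := ⟨(b - 3 * v - x' + y') / 3, by omega⟩
  have hb : b = 3 * v + 3 * t + x' - y' := by linarith
  refine ⟨t + x', t, t - y', v, ?_, by linarith⟩
  subst hv
  rw [hb] at h
  linarith

theorem lemma_1113_rep (a b : ℕ) (ha : 0 < a) (hb : 0 < b)
    (hpar : a % 2 = b % 2)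
    (h1 : b ^ 2 < 6 * a) (h2 : 5 * a < b ^ 2 + 2 * b + 6)
    (h3 : a % 9 = 3 ∨ ¬ 3 ∣ b) :
    ∃ s t u v : ℕ,
      a = s ^ 2 + t ^ 2 + u ^ 2 + 3 * v ^ 2 ∧ b = s + t + u + 3 * v := by
  have hrep : ∃ x y z : ℤ, 6 * (a : ℤ) - b ^ 2 = x ^ 2 + y ^ 2 + 3 * z ^ 2 := by
    by_cases hb3 : 3 ∣ b
    · have ha3 : a % 9 = 3 := by tauto
      obtain ⟨c, rfl⟩ := hb3
      obtain ⟨e, rfl⟩ : ∃ e, a = 9 * e + 3 := ⟨a / 9, by omega⟩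
      have hlt : c ^ 2 < 6 * e + 2 := by nlinarith
      obtain ⟨x, y, z, h⟩ := rep113 (6 * e + 2 - c ^ 2) (by omega) (by
        have : c ^ 2 % 3 = 0 ∨ c ^ 2 % 3 = 1 := by
          have hc : c % 3 = 0 ∨ c % 3 = 1 ∨ c % 3 = 2 := by omega
          rcases hc with hc | hc | hc <;> simp [pow_two, Nat.mul_mod, hc]
        omega)
      push_cast [hlt.le] at h
      refine ⟨3 * x, 3 * y, 3 * z, ?_⟩
      push_cast
      linear_combination 9 * h
    · obtain ⟨x, y, z, h⟩ := rep113 (6 * a - b ^ 2) (by omega) (by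
        have : b ^ 2 % 3 = 1 := by
          have hc : b % 3 = 1 ∨ b % 3 = 2 := by omega
          rcases hc with hc | hc <;> simp [pow_two, Nat.mul_mod, hc]
        omega)
      push_cast [h1.le] at h
      exact ⟨x, y, z, h⟩
  have hform := rep_form _ (by
    rcases Nat.even_or_odd' b with ⟨c, hc | hc⟩
    · obtain ⟨e, rfl⟩ : ∃ e, a = 2 * e := ⟨a / 2, by omega⟩
      left
      subst hc
      push_cast
      have : 6 * (2 * (e : ℤ)) - (2 * c) ^ 2 = 4 * (3 * e - c ^ 2) := by ring
      omega
    · obtain ⟨e, rfl⟩ : ∃ e, a = 2 * e + 1 := ⟨a / 2, by omega⟩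
      right
      subst hc
      push_cast
      have : 6 * (2 * (e : ℤ) + 1) - (2 * c + 1) ^ 2 = 4 * (3 * e + 1 - c ^ 2 - c) + 1 := by ring
      omega) hrep
  obtain ⟨s, t, u, v, hA, hB⟩ := int_rep _ _ hform
  have h2' : 5 * (a : ℤ) < b ^ 2 + 2 * b + 6 := by exact_mod_cast h2
  have hb' : (0 : ℤ) < b := by exact_mod_cast hb
  have aux : ∀ s t u : ℤ, (a : ℤ) = s ^ 2 + t ^ 2 + u ^ 2 + 3 * v ^ 2 →
      (b : ℤ) = s + t + u + 3 * v → 0 ≤ s := by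
    intro s t u hA hB
    by_contra hs
    have hs' : s + 1 ≤ 0 := by omega
    have c1 : (t + u + 3 * v) ^ 2 ≤ 5 * (t ^ 2 + u ^ 2 + 3 * v ^ 2) := by
      nlinarith [sq_nonneg (t - u), sq_nonneg (t - v), sq_nonneg (u - v)]
    have c2 : t + u + 3 * v = b - s := by linarith
    rw [c2] at c1
    nlinarith
  have hv : 0 ≤ v := by
    by_contra hs
    have hs' : v + 1 ≤ 0 := by omega
    have c1 : (s + t + u) ^ 2 ≤ 3 * (s ^ 2 + t ^ 2 + u ^ 2) := by
      nlinarith [sq_nonneg (t - u), sq_nonneg (t - s), sq_nonneg (u - s)]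
    have c2 : s + t + u = b - 3 * v := by linarith
    rw [c2] at c1
    nlinarith
  have hs := aux s t u hA hB
  have ht := aux t s u (by linarith) (by linarith)
  have hu := aux u t s (by linarith) (by linarith)
  lift s to ℕ using hs
  lift t to ℕ using ht
  lift u to ℕ using hu
  lift v to ℕ using hv
  exact ⟨s, t, u, v, by exact_mod_cast hA, by exact_mod_cast hB⟩
end

section
/- Let a and b be positive integers with b² < 8a and 7a < b² + 2b + 8. Suppose that one of the following three conditions holds: (i) a and b are both odd; (ii) 2 divides a and b ≡ 2 (mod 4); (iii) either (4 divides a and b ≡ 4 (mod 8)) or (a ≡ b + 4 (mod 16) and 8 divides b). Then there exist nonnegative integers s, t, u, v such that a = s² + t² + 2u² + 4v² and b = s + t + 2u + 4v. -/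
/-- There is a shift making twice the off-diagonal coefficient at most `a` in absolute value. -/
theorem exists_shift (a h : ℤ) (ha : 0 < a) : ∃ k : ℤ, 4 * (h + a * k) ^ 2 ≤ a ^ 2 := by
  refine ⟨-((2 * h + a) / (2 * a)), ?_⟩
  have h1 := Int.emod_add_mul_ediv (2 * h + a) (2 * a)
  have h2 := Int.emod_nonneg (2 * h + a) (show (2 * a) ≠ 0 by omega)
  have h3 := Int.emod_lt_of_pos (2 * h + a) (show 0 < 2 * a by omega)
  set k := (2 * h + a) / (2 * a)
  set r := (2 * h + a) % (2 * a)
  have h4 : 2 * (h + a * -k) = r - a := by linarith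
  have h5 : 4 * (h + a * -k) ^ 2 = (r - a) ^ 2 := by rw [← h4]; ring
  rw [h5]
  nlinarith

/-- Reduction of positive definite binary forms. -/
theorem binary_reduction (N : ℕ) : ∀ A B C D : ℤ, A.toNat ≤ N → 0 < A → 0 < D →
    A * C - B ^ 2 = D →
    ∃ r s t u : ℤ, r * u - s * t = 1 ∧ 0 < A * r ^ 2 + 2 * B * r * t + C * t ^ 2 ∧
      3 * (A * r ^ 2 + 2 * B * r * t + C * t ^ 2) ^ 2 ≤ 4 * D := by
  induction N with
  | zero => intro A B C D h1 h2; omega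
  | succ N ih =>
    intro A B C D hN hA hD hdet
    by_cases hs : 3 * A ^ 2 ≤ 4 * D
    · exact ⟨1, 0, 0, 1, by norm_num, by simpa using hA, by simpa using hs⟩
    · obtain ⟨k, hk⟩ := exists_shift A B hA
      have key : A * (A * k ^ 2 + 2 * B * k + C) = D + (B + A * k) ^ 2 := by
        rw [← hdet]; ring
      have hpos : 0 < A * k ^ 2 + 2 * B * k + C := by
        by_contra hc
        push Not at hc
        nlinarith [sq_nonneg (B + A * k)]
      have hlt : A * k ^ 2 + 2 * B * k + C < A := by
        by_contra hc
        push Not at hc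
        nlinarith
      obtain ⟨r, s, t, u, e1, e2, e3⟩ := ih (A * k ^ 2 + 2 * B * k + C) (-(B + A * k)) A D
        (by omega) hpos hD (by rw [← hdet]; ring)
      -- new variables: (y, z) = (k r - t, r)
      have e : A * (k * r - t) ^ 2 + 2 * B * (k * r - t) * r + C * r ^ 2
          = (A * k ^ 2 + 2 * B * k + C) * r ^ 2 + 2 * (-(B + A * k)) * r * t + A * t ^ 2 := by ring
      refine ⟨k * r - t, k * s - u, r, s, by linear_combination e1, ?_, ?_⟩
      · rw [e]; exact e2
      · rw [e]; exact e3

theorem binary_two_squares (A B C : ℤ) (hA : 0 < A) (hdet : A * C - B ^ 2 = 1) (y z : ℤ) :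
    ∃ p q : ℤ, A * y ^ 2 + 2 * B * y * z + C * z ^ 2 = p ^ 2 + q ^ 2 := by
  obtain ⟨r, s, t, u, e1, e2, e3⟩ := binary_reduction A.toNat A B C 1 le_rfl hA one_pos hdet
  have hm : A * r ^ 2 + 2 * B * r * t + C * t ^ 2 = 1 := by nlinarith
  refine ⟨(u * y - s * z) + (A * r * s + B * (r * u + s * t) + C * t * u) * (r * z - t * y),
    r * z - t * y, ?_⟩
  have hc : A * s ^ 2 + 2 * B * s * u + C * u ^ 2
      = 1 + (A * r * s + B * (r * u + s * t) + C * t * u) ^ 2 := by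
    have : (A * r ^ 2 + 2 * B * r * t + C * t ^ 2) * (A * s ^ 2 + 2 * B * s * u + C * u ^ 2)
      - (A * r * s + B * (r * u + s * t) + C * t * u) ^ 2
      = (A * C - B ^ 2) * (r * u - s * t) ^ 2 := by ring
    rw [hm, hdet, e1] at this
    linarith
  have hy : y = r * (u * y - s * z) + s * (r * z - t * y) := by linear_combination (-y) * e1
  have hz : z = t * (u * y - s * z) + u * (r * z - t * y) := by linear_combination (-z) * e1
  generalize u * y - s * z = Y at *
  generalize r * z - t * y = Z at *
  subst hy hz
  linear_combination Y ^ 2 * hm + Z ^ 2 * hc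

theorem leading_bound (a b h m : ℤ) (ha : 2 ≤ a) (hb : a ≤ b) (key : a * b = h ^ 2 + m)
    (hk : 4 * h ^ 2 ≤ a ^ 2) (hm : 3 * m ^ 2 ≤ 4 * a) : False := by
  have h3 : 3 * a ^ 2 ≤ 4 * m := by nlinarith
  have h4 : (3 * a ^ 2) * (3 * a ^ 2) ≤ (4 * m) * (4 * m) :=
    mul_self_le_mul_self (by positivity) h3
  have h5 : 27 * a ^ 4 ≤ 64 * a := by linarith
  have h7 : 4 ≤ a ^ 2 := by nlinarith
  have h8 : 8 ≤ a ^ 3 := by nlinarith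
  nlinarith

/-- Every value of a positive definite ternary form of determinant one is a sum of
three squares. -/
theorem ternary_three_squares (N : ℕ) : ∀ a b c h g f : ℤ, a.toNat ≤ N → 0 < a →
    0 < a * b - h ^ 2 →
    a * b * c + 2 * f * g * h - a * f ^ 2 - b * g ^ 2 - c * h ^ 2 = 1 →
    ∀ x y z : ℤ, ∃ p q r : ℤ,
      a * x ^ 2 + b * y ^ 2 + c * z ^ 2 + 2 * h * x * y + 2 * g * x * z + 2 * f * y * z
        = p ^ 2 + q ^ 2 + r ^ 2 := by
  induction N with
  | zero => intro a b c h g f h1 h2; omega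
  | succ N ih =>
    intro a b c h g f hN ha hD hdet x y z
    have hG : (a * b - h ^ 2) * (a * c - g ^ 2) - (a * f - h * g) ^ 2 = a := by
      linear_combination a * hdet
    by_cases ha1 : a = 1
    · subst ha1
      obtain ⟨p, q, e⟩ := binary_two_squares (1 * b - h ^ 2) (1 * f - h * g) (1 * c - g ^ 2)
        hD hG y z
      exact ⟨x + h * y + g * z, p, q, by linear_combination e⟩
    · obtain ⟨r, s, t, u, e1, e2, e3⟩ := binary_reduction _ (a * b - h ^ 2) (a * f - h * g)
        (a * c - g ^ 2) a le_rfl hD ha hG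
      obtain ⟨k, hk⟩ := exists_shift a (h * r + g * t) ha
      set m := (a * b - h ^ 2) * r ^ 2 + 2 * (a * f - h * g) * r * t + (a * c - g ^ 2) * t ^ 2
        with hm
      -- columns: e1 ; (k, r, t) ; (0, s, u)
      set h' := h * r + g * t + a * k with hh'
      set b' := a * k ^ 2 + b * r ^ 2 + c * t ^ 2 + 2 * h * k * r + 2 * g * k * t + 2 * f * r * t
        with hb'
      have key : a * b' = h' ^ 2 + m := by rw [hb', hh', hm]; ring
      have hbpos : 0 < b' := by
        by_contra hc
        push Not at hc
        nlinarith [sq_nonneg h']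
      have hblt : b' < a := by
        by_contra hc
        push Not at hc
        exact leading_bound a b' h' m (by omega) hc key hk e3
      set g' := g * u + h * s with hg'
      set f' := h * k * s + g * k * u + b * r * s + f * (r * u + s * t) + c * t * u with hf'
      set c' := b * s ^ 2 + c * u ^ 2 + 2 * f * s * u with hc'
      have hdet' : b' * a * c' + 2 * g' * f' * h' - b' * g' ^ 2 - a * f' ^ 2 - c' * h' ^ 2 = 1 := by
        have : b' * a * c' + 2 * g' * f' * h' - b' * g' ^ 2 - a * f' ^ 2 - c' * h' ^ 2
          = (a * b * c + 2 * f * g * h - a * f ^ 2 - b * g ^ 2 - c * h ^ 2)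
            * (r * u - s * t) ^ 2 := by
          rw [hb', hg', hf', hc', hh']; ring
        rw [this, hdet, e1]; norm_num
      obtain ⟨P, Q, R, e⟩ := ih b' a c' h' f' g' (by omega) hbpos (by rw [mul_comm, key, add_sub_cancel_left]; exact e2) hdet'
        (u * y - s * z) (x - k * (u * y - s * z)) (r * z - t * y)
      refine ⟨P, Q, R, ?_⟩
      rw [← e]
      have hy : y = r * (u * y - s * z) + s * (r * z - t * y) := by linear_combination (-y) * e1
      have hz : z = t * (u * y - s * z) + u * (r * z - t * y) := by linear_combination (-z) * e1
      clear_value m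
      generalize u * y - s * z = Y at *
      generalize r * z - t * y = Z at *
      rw [hb', hg', hf', hc', hh', hy, hz]; ring

/-- The criterion behind the three squares theorem. -/
theorem three_squares_of_square (n d k w : ℤ) (hd : 0 < d) (hk : 0 < d * n - 1)
    (hw : k * (d * n - 1) = d + w ^ 2) : ∃ p q r : ℤ, n = p ^ 2 + q ^ 2 + r ^ 2 := by
  have hkpos : 0 < k := by
    by_contra hc
    push Not at hc
    nlinarith [sq_nonneg w]
  obtain ⟨p, q, r, e⟩ := ternary_three_squares _ k (d * n - 1) n w 1 0 le_rfl hkpos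
    (by linarith) (by linear_combination n * hw) 0 0 1
  exact ⟨p, q, r, by linear_combination e⟩

open NumberTheorySymbols in
theorem three_squares_two (n : ℤ) (hn : 0 < n) (h4 : n % 4 = 2) :
    ∃ p q r : ℤ, n = p ^ 2 + q ^ 2 + r ^ 2 := by
  lift n to ℕ using hn.le
  have hcop : IsCoprime ((n : ℤ) - 1) ((4 * n : ℕ) : ℤ) := by
    have h2 : IsCoprime ((n : ℤ) - 1) 2 := by
      refine ⟨1, -((n : ℤ) / 2 - 1), ?_⟩
      have : (n : ℤ) = 2 * ((n : ℤ) / 2) := by omega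
      linarith
    have h1 : IsCoprime ((n : ℤ) - 1) n := ⟨-1, 1, by ring⟩
    have := (h2.mul_right h2).mul_right h1
    push_cast
    exact this
  obtain ⟨p, hpn, hp, hmod⟩ := Nat.forall_exists_prime_gt_and_zmodEq (4 * n) (q := 4 * n)
    (by omega) hcop
  obtain ⟨j, hj⟩ := hmod.symm.dvd
  push_cast at hj
  have hj0 : 0 ≤ j := by
    by_contra hc
    have : 4 * (n : ℤ) < p := by exact_mod_cast hpn
    nlinarith
  lift j to ℕ using hj0
  have : Fact p.Prime := ⟨hp⟩
  have hpd : (p : ℤ) = ((4 * j + 1 : ℕ) : ℤ) * n - 1 := by push_cast; linarith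
  have hp4 : p % 4 = 1 := by
    have h5 : (p : ℤ) = 4 * (n * j) + n - 1 := by linarith
    omega
  have hpodd : Odd p := Nat.odd_iff.mpr (by omega)
  have hJ : J(-((4 * j + 1 : ℕ) : ℤ) | p) = 1 := by
    rw [jacobiSym.neg _ hpodd, ZMod.χ₄_nat_one_mod_four hp4, one_mul,
      jacobiSym.quadratic_reciprocity_one_mod_four (by omega) hpodd,
      jacobiSym.mod_left' (a₂ := -1), jacobiSym.at_neg_one (Nat.odd_iff.mpr (by omega)),
      ZMod.χ₄_nat_one_mod_four (by omega)]
    rw [hpd]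
    exact Int.ModEq.symm ((Int.modEq_iff_dvd).mpr ⟨n, by ring⟩)
  obtain ⟨w, hw⟩ := ZMod.isSquare_of_jacobiSym_eq_one hJ
  obtain ⟨w, rfl⟩ := ZMod.intCast_surjective w
  have hw' : ((((4 * j + 1 : ℕ) : ℤ) + w ^ 2 : ℤ) : ZMod p) = 0 := by
    push_cast at hw ⊢
    linear_combination -hw
  rw [ZMod.intCast_zmod_eq_zero_iff_dvd] at hw'
  obtain ⟨k, hk⟩ := hw'
  have hp0 : (0 : ℤ) < p := by exact_mod_cast hp.pos
  exact three_squares_of_square n ((4 * j + 1 : ℕ) : ℤ) k w (by positivity) (by linarith)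
    (by rw [← hpd, hk]; ring)

open NumberTheorySymbols in
theorem three_squares_one (n : ℤ) (hn : 0 < n) (h4 : n % 4 = 1) :
    ∃ p q r : ℤ, n = p ^ 2 + q ^ 2 + r ^ 2 := by
  lift n to ℕ using hn.le
  obtain ⟨e, he⟩ : ∃ e : ℤ, 3 * (n : ℤ) - 1 = 2 * e := ⟨(3 * (n : ℤ) - 1) / 2, by omega⟩
  have hcop : IsCoprime e ((4 * n : ℕ) : ℤ) := by
    have h2 : IsCoprime e 2 := by
      refine ⟨1, -(e / 2), ?_⟩
      omega
    have h1 : IsCoprime e n := ⟨-2, 3, by linarith⟩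
    have := (h2.mul_right h2).mul_right h1
    push_cast
    exact this
  obtain ⟨p, hpn, hp, hmod⟩ := Nat.forall_exists_prime_gt_and_zmodEq (4 * n) (q := 4 * n)
    (by omega) hcop
  obtain ⟨j, hj⟩ := hmod.symm.dvd
  push_cast at hj
  have hj0 : 0 ≤ j := by
    by_contra hc
    have : 4 * (n : ℤ) < p := by exact_mod_cast hpn
    nlinarith
  lift j to ℕ using hj0
  have : Fact p.Prime := ⟨hp⟩
  have hpd : 2 * (p : ℤ) = ((8 * j + 3 : ℕ) : ℤ) * n - 1 := by push_cast; linarith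
  have hpodd : Odd p := Nat.odd_iff.mpr (by
    have h5 : (p : ℤ) = 4 * (n * j) + e := by linarith
    omega)
  have hdodd : Odd (8 * j + 3) := Nat.odd_iff.mpr (by omega)
  have hrec : J((p : ℤ) | 8 * j + 3) = 1 := by
    have hm : J(-2 | 8 * j + 3) = 1 := by
      rw [jacobiSym.at_neg_two hdodd, ZMod.χ₈'_nat_eq_if_mod_eight, if_neg (by omega),
        if_pos (by omega)]
    have hm2 : J(-2 * (p : ℤ) | 8 * j + 3) = 1 := by
      rw [jacobiSym.mod_left' (a₂ := 1), jacobiSym.one_left]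
      have : -2 * (p : ℤ) = 1 - ((8 * j + 3 : ℕ) : ℤ) * n := by linarith
      rw [this]
      exact (Int.modEq_iff_dvd).mpr ⟨n, by ring⟩
    rwa [jacobiSym.mul_left, hm, one_mul] at hm2
  have hJ : J(-((8 * j + 3 : ℕ) : ℤ) | p) = 1 := by
    rw [jacobiSym.neg _ hpodd]
    rcases (show p % 4 = 1 ∨ p % 4 = 3 by have := Nat.odd_iff.mp hpodd; omega) with hp4 | hp4
    · rw [ZMod.χ₄_nat_one_mod_four hp4, one_mul,
        jacobiSym.quadratic_reciprocity_one_mod_four' hdodd hp4, hrec]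
    · rw [ZMod.χ₄_nat_three_mod_four hp4,
        jacobiSym.quadratic_reciprocity_three_mod_four (by omega) hp4, hrec]
      norm_num
  obtain ⟨w, hw⟩ := ZMod.isSquare_of_jacobiSym_eq_one hJ
  obtain ⟨w, rfl⟩ := ZMod.intCast_surjective w
  have hw' : ((((8 * j + 3 : ℕ) : ℤ) + w ^ 2 : ℤ) : ZMod p) = 0 := by
    push_cast at hw ⊢
    linear_combination -hw
  rw [ZMod.intCast_zmod_eq_zero_iff_dvd] at hw'
  have hp0 : (0 : ℤ) < p := by exact_mod_cast hp.pos
  have hp2 : (p : ℤ) % 2 = 1 := by have := Nat.odd_iff.mp hpodd; omega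
  -- adjust the root so that it is odd
  obtain ⟨v, hv, hvp⟩ : ∃ v : ℤ, v % 2 = 1 ∧ (p : ℤ) ∣ ((8 * j + 3 : ℕ) : ℤ) + v ^ 2 := by
    rcases Int.emod_two_eq_zero_or_one w with h | h
    · refine ⟨w + p, by omega, ?_⟩
      have : ((8 * j + 3 : ℕ) : ℤ) + (w + p) ^ 2
          = (((8 * j + 3 : ℕ) : ℤ) + w ^ 2) + p * (2 * w + p) := by ring
      rw [this]
      exact dvd_add hw' (dvd_mul_right _ _)
    · exact ⟨w, h, hw'⟩
  have h2dvd : (2 : ℤ) ∣ ((8 * j + 3 : ℕ) : ℤ) + v ^ 2 := by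
    obtain ⟨m, rfl⟩ : ∃ m, v = 2 * m + 1 := ⟨v / 2, by omega⟩
    exact ⟨4 * j + 2 + 2 * m ^ 2 + 2 * m, by push_cast; ring⟩
  have hcp : IsCoprime (2 : ℤ) p := ⟨-((p : ℤ) / 2), 1, by omega⟩
  obtain ⟨k, hk⟩ := hcp.mul_dvd h2dvd hvp
  exact three_squares_of_square n ((8 * j + 3 : ℕ) : ℤ) k v (by positivity) (by linarith)
    (by rw [← hpd, hk]; ring)

theorem nat_of_int (a b : ℕ) (h2 : 7 * a < b ^ 2 + 2 * b + 8) (s t u v : ℤ)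
    (ha : (a : ℤ) = s ^ 2 + t ^ 2 + 2 * u ^ 2 + 4 * v ^ 2)
    (hb : (b : ℤ) = s + t + 2 * u + 4 * v) :
    ∃ s t u v : ℕ,
      a = s ^ 2 + t ^ 2 + 2 * u ^ 2 + 4 * v ^ 2 ∧ b = s + t + 2 * u + 4 * v := by
  have h2' : 7 * (a : ℤ) < b ^ 2 + 2 * b + 8 := by exact_mod_cast h2
  have hb0 : (0 : ℤ) ≤ b := by positivity
  have aux : ∀ s t : ℤ, (a : ℤ) = s ^ 2 + t ^ 2 + 2 * u ^ 2 + 4 * v ^ 2 →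
      (b : ℤ) = s + t + 2 * u + 4 * v → 0 ≤ s := by
    intro s t ha hb
    by_contra hc
    have hc : s ≤ -1 := by omega
    have e1 : (b - s : ℤ) ^ 2 ≤ 7 * (a - s ^ 2) := by
      rw [ha, hb]
      nlinarith [sq_nonneg (t - u), sq_nonneg (t - v), sq_nonneg (u - v)]
    nlinarith
  have hs := aux s t ha hb
  have ht := aux t s (by linarith) (by linarith)
  have hu : 0 ≤ u := by
    by_contra hc
    have hc : u ≤ -1 := by omega
    have e1 : (b - 2 * u : ℤ) ^ 2 ≤ 6 * (a - 2 * u ^ 2) := by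
      rw [ha, hb]
      nlinarith [sq_nonneg (s - t), sq_nonneg (s - v), sq_nonneg (t - v)]
    nlinarith
  have hv : 0 ≤ v := by
    by_contra hc
    have hc : v ≤ -1 := by omega
    have e1 : (b - 4 * v : ℤ) ^ 2 ≤ 4 * (a - 4 * v ^ 2) := by
      rw [ha, hb]
      nlinarith [sq_nonneg (s - t), sq_nonneg (s - u), sq_nonneg (t - u)]
    nlinarith
  lift s to ℕ using hs
  lift t to ℕ using ht
  lift u to ℕ using hu
  lift v to ℕ using hv
  exact ⟨s, t, u, v, by exact_mod_cast ha, by exact_mod_cast hb⟩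

theorem assemble (a b : ℕ) (h2 : 7 * a < b ^ 2 + 2 * b + 8) (x y z : ℤ)
    (h : 8 * (a : ℤ) - b ^ 2 = z ^ 2 + 2 * y ^ 2 + 4 * x ^ 2)
    (hz : 8 ∣ (b : ℤ) - z) (hy : 8 ∣ (b : ℤ) + z - 2 * y)
    (hx : 8 ∣ (b : ℤ) + z + 2 * y - 4 * x) :
    ∃ s t u v : ℕ,
      a = s ^ 2 + t ^ 2 + 2 * u ^ 2 + 4 * v ^ 2 ∧ b = s + t + 2 * u + 4 * v := by
  obtain ⟨v, hv⟩ := hz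
  obtain ⟨u, hu⟩ := hy
  obtain ⟨t, ht⟩ := hx
  have hz : z = b - 8 * v := by linarith
  have hy : y = b - 4 * v - 4 * u := by linarith
  have hx : x = b - 4 * v - 2 * u - 2 * t := by linarith
  refine nat_of_int a b h2 (t + x) t u v ?_ (by linarith)
  rw [hz, hy, hx] at h
  rw [hx]
  linarith

theorem sq_mod_four (x : ℤ) : (x % 2 = 0 ∧ x ^ 2 % 4 = 0) ∨ (x % 2 = 1 ∧ x ^ 2 % 8 = 1) := by
  obtain ⟨k, rfl | rfl⟩ := Int.even_or_odd' x
  · left; ring_nf; omega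
  · right
    obtain ⟨j, rfl | rfl⟩ := Int.even_or_odd' k
    · ring_nf; omega
    · ring_nf; omega

theorem sq_add_two (n : ℤ) (hn : 0 < n) (h2 : n % 2 = 1) :
    ∃ z w y : ℤ, n = z ^ 2 + w ^ 2 + 2 * y ^ 2 ∧ z % 2 = 1 ∧ w % 2 = 0 := by
  obtain ⟨p, q, r, e⟩ := three_squares_two (2 * n) (by omega) (by omega)
  have main : ∀ p q r : ℤ, 2 * n = p ^ 2 + q ^ 2 + r ^ 2 → p % 2 = 1 → q % 2 = 1 → r % 2 = 0 →
      ∃ z w y : ℤ, n = z ^ 2 + w ^ 2 + 2 * y ^ 2 ∧ z % 2 = 1 ∧ w % 2 = 0 := by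
    intro p q r e hp hq hr
    obtain ⟨z, hz⟩ : ∃ z, p + q = 2 * z := ⟨(p + q) / 2, by omega⟩
    obtain ⟨y, rfl⟩ : ∃ y, r = 2 * y := ⟨r / 2, by omega⟩
    have hp' : p = 2 * z - q := by linarith
    subst hp'
    have e' : n = z ^ 2 + (z - q) ^ 2 + 2 * y ^ 2 := by linarith
    rcases Int.emod_two_eq_zero_or_one z with h | h
    · exact ⟨z - q, z, y, by linarith, by omega, h⟩
    · exact ⟨z, z - q, y, e', h, by omega⟩
  rcases sq_mod_four p with hp | hp <;> rcases sq_mod_four q with hq | hq <;>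
    rcases sq_mod_four r with hr | hr
  · omega
  · omega
  · omega
  · exact main q r p (by linarith) hq.1 hr.1 hp.1
  · omega
  · exact main p r q (by linarith) hp.1 hr.1 hq.1
  · exact main p q r e hp.1 hq.1 hr.1
  · omega

theorem sq_two_two (n : ℤ) (hn : 0 < n) (h4 : n % 4 = 1) :
    ∃ x y z : ℤ, n = y ^ 2 + 2 * z ^ 2 + 2 * x ^ 2 ∧ y % 2 = 1 := by
  obtain ⟨p, q, r, e⟩ := three_squares_one n hn h4
  have main : ∀ p q r : ℤ, n = p ^ 2 + q ^ 2 + r ^ 2 → p % 2 = 1 → q % 2 = 0 → r % 2 = 0 →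
      ∃ x y z : ℤ, n = y ^ 2 + 2 * z ^ 2 + 2 * x ^ 2 ∧ y % 2 = 1 := by
    intro p q r e hp hq hr
    obtain ⟨z, hz⟩ : ∃ z, q + r = 2 * z := ⟨(q + r) / 2, by omega⟩
    have hq' : q = 2 * z - r := by linarith
    subst hq'
    exact ⟨z - r, p, z, by linarith, hp⟩
  rcases sq_mod_four p with hp | hp <;> rcases sq_mod_four q with hq | hq <;>
    rcases sq_mod_four r with hr | hr
  · omega
  · exact main r p q (by linarith) hr.1 hp.1 hq.1
  · exact main q p r (by linarith) hq.1 hp.1 hr.1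
  · omega
  · exact main p q r e hp.1 hq.1 hr.1
  · omega
  · omega
  · omega

theorem sq_mod_sixteen (x : ℤ) (h : x % 2 = 1) :
    (x ^ 2 % 16 = 1 ∧ (x % 8 = 1 ∨ x % 8 = 7)) ∨ (x ^ 2 % 16 = 9 ∧ (x % 8 = 3 ∨ x % 8 = 5)) := by
  have h8 : x % 8 = 1 ∨ x % 8 = 3 ∨ x % 8 = 5 ∨ x % 8 = 7 := by omega
  obtain ⟨k, hk⟩ : ∃ k, k = x / 8 := ⟨_, rfl⟩
  rcases h8 with h8 | h8 | h8 | h8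
  · obtain rfl : x = 8 * k + 1 := by omega
    left; refine ⟨?_, by omega⟩; ring_nf; omega
  · obtain rfl : x = 8 * k + 3 := by omega
    right; refine ⟨?_, by omega⟩; ring_nf; omega
  · obtain rfl : x = 8 * k + 5 := by omega
    right; refine ⟨?_, by omega⟩; ring_nf; omega
  · obtain rfl : x = 8 * k + 7 := by omega
    left; refine ⟨?_, by omega⟩; ring_nf; omega

theorem lemma_1124_rep (a b : ℕ) (ha : 0 < a) (hb : 0 < b)
    (h1 : b ^ 2 < 8 * a) (h2 : 7 * a < b ^ 2 + 2 * b + 8)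
    (hcond : (Odd a ∧ Odd b) ∨ (2 ∣ a ∧ b % 4 = 2) ∨
      ((4 ∣ a ∧ b % 8 = 4) ∨ (a % 16 = (b + 4) % 16 ∧ 8 ∣ b))) :
    ∃ s t u v : ℕ,
      a = s ^ 2 + t ^ 2 + 2 * u ^ 2 + 4 * v ^ 2 ∧ b = s + t + 2 * u + 4 * v := by
  have h1' : (b : ℤ) ^ 2 < 8 * a := by exact_mod_cast h1
  rcases hcond with ⟨hao, hbo⟩ | ⟨ha2, hb4⟩ | ⟨ha4, hb8⟩ | ⟨hab, hb8⟩
  · have ha1 : (a : ℤ) % 2 = 1 := by have := Nat.odd_iff.mp hao; omega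
    have hb1 : (b : ℤ) % 2 = 1 := by have := Nat.odd_iff.mp hbo; omega
    have hbs := sq_mod_sixteen b hb1
    obtain ⟨z, w, y, e, hz, hw⟩ := sq_add_two (8 * a - b ^ 2) (by omega) (by omega)
    obtain ⟨x, rfl⟩ : ∃ x, w = 2 * x := ⟨w / 2, by omega⟩
    have e' : 8 * (a : ℤ) - b ^ 2 = z ^ 2 + 2 * y ^ 2 + 4 * x ^ 2 := by rw [e]; ring
    have hzs := sq_mod_sixteen z hz
    have hy := sq_mod_four y
    have hx := sq_mod_four x
    have hy1 : y % 2 = 1 := by omega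
    have hx1 : x % 2 = 1 := by omega
    have hzb : 8 ∣ (b : ℤ) - z ∨ 8 ∣ (b : ℤ) + z := by omega
    have main : ∀ z : ℤ, 8 * (a : ℤ) - b ^ 2 = z ^ 2 + 2 * y ^ 2 + 4 * x ^ 2 →
        8 ∣ (b : ℤ) - z → ∃ s t u v : ℕ,
        a = s ^ 2 + t ^ 2 + 2 * u ^ 2 + 4 * v ^ 2 ∧ b = s + t + 2 * u + 4 * v := by
      intro z e' hzb
      have hyz : 8 ∣ (b : ℤ) + z - 2 * y ∨ 8 ∣ (b : ℤ) + z - 2 * (-y) := by omega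
      rcases hyz with h | h
      · exact assemble a b h2 x y z e' hzb h (by omega)
      · exact assemble a b h2 x (-y) z (by rw [e']; ring) hzb h (by omega)
    rcases hzb with h | h
    · exact main z e' h
    · exact main (-z) (by rw [e']; ring) (by omega)
  · obtain ⟨a', rfl⟩ := ha2
    obtain ⟨c, rfl⟩ : ∃ c, b = 2 * c := ⟨b / 2, by omega⟩
    push_cast at h1'
    have hc : (c : ℤ) % 2 = 1 := by omega
    have hcs := sq_mod_four (c : ℤ)
    obtain ⟨z, x, y, e, hz, hx⟩ := sq_add_two (4 * a' - c ^ 2) (by linarith) (by omega)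
    have hys := sq_mod_four y
    have hxs := sq_mod_four x
    have hzs := sq_mod_four z
    have hy1 : y % 2 = 1 := by omega
    have hzb : (4 : ℤ) ∣ c - z ∨ (4 : ℤ) ∣ c + z := by omega
    rcases hzb with h | h
    · exact assemble _ _ h2 x (2 * y) (2 * z) (by push_cast; linarith) (by push_cast; omega)
        (by push_cast; omega) (by push_cast; omega)
    · exact assemble _ _ h2 x (2 * y) (-(2 * z)) (by push_cast; linarith) (by push_cast; omega)
        (by push_cast; omega) (by push_cast; omega)
  · obtain ⟨a', rfl⟩ := ha4
    obtain ⟨c, rfl⟩ : ∃ c, b = 4 * c := ⟨b / 4, by omega⟩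
    push_cast at h1'
    have hc : (c : ℤ) % 2 = 1 := by omega
    have hcs := sq_mod_four (c : ℤ)
    obtain ⟨z, x, y, e, hz, hx⟩ := sq_add_two (2 * a' - c ^ 2) (by linarith) (by omega)
    have hp : (2 : ℤ) ∣ x := by omega
    exact assemble _ _ h2 (2 * x) (4 * y) (4 * z) (by push_cast; linarith) (by push_cast; omega)
        (by push_cast; omega) (by push_cast; omega)
  · obtain ⟨c, rfl⟩ := hb8
    obtain ⟨a', rfl⟩ : ∃ c, a = 4 * c := ⟨a / 4, by omega⟩
    push_cast at h1'
    have hcs := sq_mod_four (c : ℤ)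
    obtain ⟨x, y, z, e, hy⟩ := sq_two_two (a' - 2 * c ^ 2) (by linarith) (by omega)
    have hp : (a' : ℤ) % 4 = (2 * c + 1) % 4 := by omega
    exact assemble _ _ h2 (4 * x) (4 * y) (8 * z) (by push_cast; linarith) (by push_cast; omega)
        (by push_cast; omega) (by push_cast; omega)
end
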